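/- Let R ⊆ Z ⊆ T be as above and suppose m is a maximal ideal of R such that every maximal ideal of Z lying over m is in the Azumaya locus of T. Then T/mT ≅ Mat_n(Z/mZ) as k-algebras, where n is the PI degree of T. -/

import Mathlib

/-- `n` is the PI degree of the affine `k`-algebra `T` finite over its center: equivalently,
`n` is the maximum of the `k`-dimensions of the simple `T`-modules (this maximum is attained). -/
def IsPIDegree (k T : Type*) [Field k] [Ring T] [Algebra k T] (n : ℕ) : Prop :=
  IsGreatest {d : ℕ | ∃ (V : Type) (_ : AddCommGroup V) (_ : Module k V) (_ : Module T V)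
    (_ : IsScalarTower k T V), IsSimpleModule T V ∧ Module.finrank k V = d} n

theorem mem_twoSidedIdeal_span_algebraMap_image {Z T : Type*} [CommRing Z] [Ring T] [Algebra Z T]
    (I : Ideal Z) (t : T) :
    t ∈ TwoSidedIdeal.span (algebraMap Z T '' (I : Set Z)) ↔
      t ∈ I • (⊤ : Submodule Z T) := by
  constructor
  · intro h
    induction h using TwoSidedIdeal.span_induction with
    | mem x hx =>
      obtain ⟨z, hz, rfl⟩ := hx
      rw [Algebra.algebraMap_eq_smul_one]
      exact Submodule.smul_mem_smul hz trivial
    | zero => exact zero_mem _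
    | add x y _ _ hx hy => exact add_mem hx hy
    | neg x _ hx => exact neg_mem hx
    | left_absorb a x _ hx =>
      refine Submodule.smul_induction_on hx (fun z hz y _ ↦ ?_) fun x y hx hy ↦ ?_
      · rw [mul_smul_comm]
        exact Submodule.smul_mem_smul hz trivial
      · rw [mul_add]
        exact add_mem hx hy
    | right_absorb a x _ hx =>
      refine Submodule.smul_induction_on hx (fun z hz y _ ↦ ?_) fun x y hx hy ↦ ?_
      · rw [smul_mul_assoc]
        exact Submodule.smul_mem_smul hz trivial
      · rw [add_mul]
        exact add_mem hx hy
  · intro h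
    refine Submodule.smul_induction_on h (fun z hz y _ ↦ ?_) fun x y hx hy ↦ add_mem hx hy
    rw [Algebra.smul_def]
    exact TwoSidedIdeal.mul_mem_right _ _ _ (TwoSidedIdeal.subset_span ⟨z, hz, rfl⟩)

/-- Lifts of the matrix units along a ring homomorphism from a torsion-free algebra to a matrix
ring are linearly independent: a generalized Capelli polynomial does not vanish on them. -/
theorem linearIndependent_of_map_eq_single {Z T F ι : Type*} [CommRing Z] [IsDomain Z] [Ring T]
    [Algebra Z T] [Module.IsTorsionFree Z T] [CommRing F] [Nontrivial F] [Fintype ι] [DecidableEq ι]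
    (π : T →+* Matrix ι ι F) (hπ : Function.Surjective π)
    (x : ι × ι → T) (hx : ∀ p, π (x p) = Matrix.single p.1 p.2 1) :
    LinearIndependent Z x := by
  cases isEmpty_or_nonempty ι with
  | inl _ => exact linearIndependent_empty_type
  | inr hne =>
  obtain ⟨c⟩ := hne
  let e := Fintype.equivFin (ι × ι)
  rw [← linearIndependent_equiv e.symm]
  by_contra hdep
  choose y hy using fun i ↦ hπ (Matrix.single c (e.symm i).1 (1 : F))
  choose w hw using fun i ↦ hπ (Matrix.single (e.symm i).2 c (1 : F))
  let m : MultilinearMap Z (fun _ : Fin (Fintype.card (ι × ι)) ↦ T) T :=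
    (MultilinearMap.mkPiAlgebraFin Z _ T).compLinearMap
      fun i ↦ LinearMap.mulLeft Z (y i) ∘ₗ LinearMap.mulRight Z (w i)
  have h0 := congrArg π ((MultilinearMap.alternatization m).map_linearDependent _ hdep)
  have key : ∀ σ : Equiv.Perm (Fin (Fintype.card (ι × ι))),
      π (m fun i ↦ (x ∘ e.symm) (σ i)) = if σ = 1 then Matrix.single c c 1 else 0 := by
    intro σ
    have h1 : ∀ i, π (y i * ((x ∘ e.symm) (σ i) * w i)) =
        if σ i = i then Matrix.single c c 1 else 0 := by
      intro i
      simp only [map_mul, hy, hw, Function.comp, hx]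
      split_ifs with h
      · simp [h]
      · have : e.symm i ≠ e.symm (σ i) := fun h' ↦ h (e.symm.injective h'.symm)
        rw [Ne, Prod.ext_iff, not_and_or] at this
        rcases this with h' | h'
        · rw [← mul_assoc, Matrix.single_mul_single_of_ne _ _ _ _ h', zero_mul]
        · rw [Matrix.single_mul_single_of_ne _ _ _ _ (Ne.symm h'), mul_zero]
    have h2 : π (m fun i ↦ (x ∘ e.symm) (σ i)) =
        (List.ofFn fun i ↦ if σ i = i then Matrix.single c c (1 : F) else 0).prod := by
      simp only [m, MultilinearMap.compLinearMap_apply, MultilinearMap.mkPiAlgebraFin_apply,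
        map_list_prod, List.map_ofFn]
      congr 2
      funext i
      exact h1 i
    rw [h2]
    split_ifs with h
    · subst h
      have hpos : Fintype.card ι * Fintype.card ι ≠ 0 := by
        have : Nonempty ι := ⟨c⟩
        simp
      have hid : IsIdempotentElem (Matrix.single c c (1 : F)) := by simp [IsIdempotentElem]
      simp [hid.pow_eq hpos]
    · apply List.prod_eq_zero
      by_contra hn
      apply h
      ext1 i
      by_contra hi
      exact hn (List.mem_ofFn.mpr ⟨i, by rw [if_neg (by simpa using hi)]⟩)
  rw [MultilinearMap.alternatization_apply, map_sum, map_zero] at h0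
  have h3 : ∀ σ : Equiv.Perm (Fin (Fintype.card (ι × ι))),
      π (Equiv.Perm.sign σ • m.domDomCongr σ (x ∘ e.symm)) =
        if σ = 1 then Matrix.single c c 1 else 0 := by
    intro σ
    rw [Units.smul_def, map_zsmul, MultilinearMap.domDomCongr_apply, key]
    split_ifs with h
    · simp [h]
    · simp
  simp only [h3, Finset.sum_ite_eq', Finset.mem_univ, if_true] at h0
  have := congrFun (congrFun h0 c) c
  simp at this

/-- A linearly independent family in a module that becomes spanned by `m` elements after
multiplication by a nonzero scalar has at most `m` members. -/
theorem LinearIndependent.card_le_of_smul_mem_span {Z T ι κ : Type*} [CommRing Z] [IsDomain Z]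
    [AddCommGroup T] [Module Z T] [Fintype ι] [Fintype κ] {v : ι → T}
    (hv : LinearIndependent Z v) (x : κ → T) {s : Z} (hs : s ≠ 0)
    (hx : ∀ t : T, s • t ∈ Submodule.span Z (Set.range x)) :
    Fintype.card ι ≤ Fintype.card κ := by
  let w : ι → Submodule.span Z (Set.range x) := fun i ↦ ⟨s • v i, hx _⟩
  have hw : LinearIndependent Z w := by
    apply LinearIndependent.of_comp (Submodule.span Z (Set.range x)).subtype
    rw [Fintype.linearIndependent_iff] at hv ⊢
    intro g hg i
    have := hv (fun i ↦ g i * s) (by simpa [mul_smul, w] using hg) i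
    exact (mul_eq_zero.mp this).resolve_right hs
  have := Module.Finite.span_of_finite Z (Set.finite_range x)
  have h1 := hw.fintype_card_le_finrank
  exact h1.trans (finrank_range_le_card x)

/-- If the matrix units of the fibre of `T` at `M` lift to `x`, then `x` generates `T` up to an
element outside of `M`. -/
theorem exists_smul_mem_span_of_map_eq_single {k Z T ι : Type*} [Field k] [CommRing Z]
    [Algebra k Z] [Ring T] [Algebra k T] [Algebra Z T] [IsScalarTower k Z T] [Module.Finite Z T]
    [Fintype ι] [DecidableEq ι] (M : Ideal Z) (hM : M ≠ ⊤)
    (ψ : T →ₐ[k] Matrix ι ι k) (hker : ∀ t, ψ t = 0 → t ∈ M • (⊤ : Submodule Z T))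
    (x : ι × ι → T) (hx : ∀ p, ψ (x p) = Matrix.single p.1 p.2 1) :
    ∃ s ∉ M, ∀ t : T, s • t ∈ Submodule.span Z (Set.range x) := by
  have hle : (⊤ : Submodule Z T) ≤ Submodule.span Z (Set.range x) ⊔ M • ⊤ := by
    intro t _
    have h1 : t - ∑ p : ι × ι, ψ t p.1 p.2 • x p ∈ M • (⊤ : Submodule Z T) := by
      apply hker
      rw [map_sub, map_sum, sub_eq_zero]
      simp only [map_smul, hx, Fintype.sum_prod_type, Matrix.smul_single, smul_eq_mul, mul_one]
      exact Matrix.matrix_eq_sum_single _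
    rw [← sub_add_cancel t (∑ p : ι × ι, ψ t p.1 p.2 • x p), add_comm]
    refine add_mem (Submodule.mem_sup_left (sum_mem fun p _ ↦ ?_)) (Submodule.mem_sup_right h1)
    rw [← algebraMap_smul Z]
    exact Submodule.smul_mem _ _ (Submodule.subset_span ⟨p, rfl⟩)
  obtain ⟨s, hs, hs'⟩ :=
    Submodule.exists_sub_one_mem_and_smul_le_of_fg_of_le_sup Module.Finite.fg_top le_rfl hle
  refine ⟨s, fun h ↦ hM ((Ideal.eq_top_iff_one M).mpr ?_), fun t ↦ hs' ?_⟩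
  · simpa using sub_mem h hs
  · exact Submodule.smul_mem_pointwise_smul _ _ _ trivial

/-- At a maximal ideal `M` of the affine domain `Z` with `MT` maximal, the fibre of `T` is a matrix
algebra over `k`. -/
theorem exists_fibre_map {k Z T : Type*} [Field k] [IsAlgClosed k] [CommRing Z]
    [Algebra k Z] [Algebra.FiniteType k Z] [Ring T] [Algebra k T] [Algebra Z T]
    [IsScalarTower k Z T] [Module.Finite Z T] (M : Ideal Z) (hM : M.IsMaximal)
    (hc : IsCoatom (TwoSidedIdeal.span (algebraMap Z T '' (M : Set Z)))) :
    ∃ (d : ℕ) (_ : NeZero d) (ψ : T →ₐ[k] Matrix (Fin d) (Fin d) k), Function.Surjective ψ ∧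
      ∀ t, ψ t = 0 ↔ t ∈ TwoSidedIdeal.span (algebraMap Z T '' (M : Set Z)) := by
  set P := TwoSidedIdeal.span (algebraMap Z T '' (M : Set Z)) with hP
  let Q := P.ringCon.Quotient
  have hmk : Function.Surjective P.ringCon.mk' := P.ringCon.mk'_surjective
  have hmk0 (t : T) : P.ringCon.mk' t = 0 ↔ t ∈ P := by
    rw [← TwoSidedIdeal.mem_ker, TwoSidedIdeal.ker_ringCon_mk']
  have hsimple : IsSimpleRing Q := by
    refine ⟨{ toNontrivial := ?_, eq_bot_or_eq_top := fun J ↦ ?_ }⟩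
    · have : Nontrivial Q := by
        refine ⟨⟨1, 0, fun h ↦ hc.1 ?_⟩⟩
        rw [← TwoSidedIdeal.one_mem_iff, ← hmk0, map_one]
        exact h
      infer_instance
    · have hle : P ≤ J.comap P.ringCon.mk' := fun t ht ↦ by
        rw [TwoSidedIdeal.mem_comap, (hmk0 t).mpr ht]
        exact J.zero_mem
      rcases hc.le_iff.mp hle with h | h
      · right
        rw [← TwoSidedIdeal.one_mem_iff, ← map_one P.ringCon.mk', ← TwoSidedIdeal.mem_comap, h]
        trivial
      · left
        refine le_bot_iff.mp fun q hq ↦ ?_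
        obtain ⟨t, rfl⟩ := hmk q
        rw [← TwoSidedIdeal.mem_comap, h, ← hmk0] at hq
        rw [hq]
        exact zero_mem _
  have hfin : FiniteDimensional k Q := by
    let _ : Field (Z ⧸ M) := Ideal.Quotient.field M
    have hk : Module.Finite k (Z ⧸ M) := finite_of_finite_type_of_isJacobsonRing k (Z ⧸ M)
    have hZQ : Module.Finite Z Q :=
      Module.Finite.of_surjective (P.ringCon.mkₐ Z).toLinearMap hmk
    have htor : Module.IsTorsionBySet Z Q M := by
      rintro q ⟨z, hz⟩
      obtain ⟨t, rfl⟩ := hmk q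
      change P.ringCon.mk' (z • t) = 0
      rw [hmk0, Algebra.smul_def]
      exact TwoSidedIdeal.mul_mem_right _ _ _ (TwoSidedIdeal.subset_span ⟨z, hz, rfl⟩)
    let _ : Module (Z ⧸ M) Q := htor.module
    have : IsScalarTower Z (Z ⧸ M) Q := htor.isScalarTower
    have : Module.Finite (Z ⧸ M) Q := Module.Finite.of_restrictScalars_finite Z _ _
    have : IsScalarTower k Z Q := by
      constructor
      intro a z q
      obtain ⟨t, rfl⟩ := hmk q
      change P.ringCon.mk' ((a • z) • t) = P.ringCon.mk' (a • (z • t))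
      rw [smul_assoc]
    have : IsScalarTower k (Z ⧸ M) Q := by
      constructor
      intro a z q
      obtain ⟨z, rfl⟩ := Ideal.Quotient.mk_surjective z
      change (a • z) • q = a • (z • q)
      rw [smul_assoc]
    exact Module.Finite.trans (Z ⧸ M) Q
  obtain ⟨d, hd, ⟨e⟩⟩ := IsSimpleRing.exists_algEquiv_matrix_of_isAlgClosed k Q
  refine ⟨d, hd, e.toAlgHom.comp (P.ringCon.mkₐ k), e.surjective.comp hmk, fun t ↦ ?_⟩
  rw [← hmk0]
  exact e.map_eq_zero_iff

/-- Burnside's theorem, in matrix form. -/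
theorem exists_surjective_map_matrix {k T V : Type*} [Field k] [IsAlgClosed k] [Ring T]
    [Algebra k T] [AddCommGroup V] [Module k V] [Module T V] [IsScalarTower k T V]
    [IsSimpleModule T V] [FiniteDimensional k V] :
    ∃ π : T →+* Matrix (Fin (Module.finrank k V)) (Fin (Module.finrank k V)) k,
      Function.Surjective π := by
  let b := Module.finBasis k V
  let e := algEquivMatrix b
  refine ⟨(e : Module.End k V →+* _).comp (Algebra.lsmul k k V (A := T) : T →+* Module.End k V),
    e.surjective.comp fun f ↦ ?_⟩
  have hb := IsSimpleModule.algebraMap_end_bijective_of_isAlgClosed (A := T) (V := V) k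
  let g : Module.End (Module.End T V) V :=
    { f with
      map_smul' := fun a v ↦ by
        obtain ⟨c, rfl⟩ := hb.2 a
        exact f.map_smul c v }
  classical
  obtain ⟨t, ht⟩ := jacobson_density g (Finset.univ.image b)
  refine ⟨t, b.ext fun i ↦ ?_⟩
  exact (ht (b i) (by simp)).symm

theorem le_of_isPIDegree {k T : Type*} [Field k] [Ring T] [Algebra k T] {n d : ℕ} [NeZero d]
    (hn : IsPIDegree k T n) (ψ : T →ₐ[k] Matrix (Fin d) (Fin d) k) (hψ : Function.Surjective ψ) :
    d ≤ n := by
  obtain ⟨V, _, _, _, _, hV, -⟩ := hn.1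
  have := IsSimpleModule.nontrivial T V
  obtain ⟨v, hv⟩ := exists_ne (0 : V)
  have : Small.{0} k := small_of_injective (smul_left_injective k hv)
  let W := Shrink.{0} (Fin d → k)
  let e : W ≃ₗ[k] (Fin d → k) := Shrink.linearEquiv k _
  let φ : T →ₐ[k] Module.End k W := (e.symm.conjAlgEquiv k).toAlgHom.comp
    ((Matrix.toLinAlgEquiv' : _ ≃ₐ[k] Module.End k (Fin d → k)).toAlgHom.comp ψ)
  have hφ : Function.Surjective φ :=
    (e.symm.conjAlgEquiv k).surjective.comp (Matrix.toLinAlgEquiv'.surjective.comp hψ)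
  let _ : Module T W := Module.compHom W φ.toRingHom
  have hsm (t : T) (w : W) : t • w = φ t w := rfl
  have : IsScalarTower k T W := ⟨fun a t w ↦ by simp [hsm]⟩
  have hnt : Nontrivial W := e.toEquiv.nontrivial
  refine hn.2 ⟨W, _, _, _, this, ?_, ?_⟩
  · rw [isSimpleModule_iff_toSpanSingleton_surjective]
    refine ⟨inferInstance, fun w hw w' ↦ ?_⟩
    obtain ⟨f, hf⟩ := (isSimpleModule_iff_toSpanSingleton_surjective.mp
      (inferInstance : IsSimpleModule (Module.End k W) W)).2 w hw w'
    obtain ⟨t, rfl⟩ := hφ f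
    exact ⟨t, hf⟩
  · rw [e.finrank_eq, Module.finrank_fin_fun]

/-- A family of elements multiplying like the standard matrix units. -/
structure IsMatrixUnits {ι R : Type*} [Fintype ι] [DecidableEq ι] [Ring R] (f : ι → ι → R) :
    Prop where
  mul_eq : ∀ i j k l, f i j * f k l = if j = k then f i l else 0
  sum_eq : ∑ i, f i i = 1

/-- Matrix units lift along nil ideals. -/
theorem IsMatrixUnits.exists_lift {ι R S : Type*} [Fintype ι] [DecidableEq ι] [Ring R] [Ring S]
    (f : R →+* S) (hf : ∀ x ∈ RingHom.ker f, IsNilpotent x) {E : ι → ι → S}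
    (hE : IsMatrixUnits E) (hrange : ∀ i j, E i j ∈ f.range) :
    ∃ F : ι → ι → R, IsMatrixUnits F ∧ ∀ i j, f (F i j) = E i j := by
  have hcomplete : CompleteOrthogonalIdempotents fun i ↦ E i i :=
    { idem := fun i ↦ by simp [IsIdempotentElem, hE.mul_eq]
      ortho := fun i j hij ↦ by simp [hE.mul_eq, hij]
      complete := hE.sum_eq }
  obtain ⟨e, he, hfe⟩ := hcomplete.lift_of_isNilpotent_ker f hf fun i ↦ hrange i i
  replace hfe (i : ι) : f (e i) = E i i := congrFun hfe i
  cases isEmpty_or_nonempty ι with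
  | inl _ => exact ⟨fun i ↦ isEmptyElim i, ⟨isEmptyElim, by simpa using he.complete⟩, isEmptyElim⟩
  | inr hne =>
  obtain ⟨c⟩ := hne
  have hcorner (i : ι) : ∃ a b : R, f a = E c i ∧ f b = E i c ∧ a * b = e c ∧ b * a = e i ∧
      a * e i = a ∧ e i * b = b ∧ b * e c = b := by
    obtain ⟨a₀, ha₀⟩ := hrange c i
    obtain ⟨b₀, hb₀⟩ := hrange i c
    have hi := (he.idem i).eq
    have hc := (he.idem c).eq
    obtain ⟨a, ha⟩ : ∃ a, a = e c * a₀ * e i := ⟨_, rfl⟩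
    obtain ⟨b, hb⟩ : ∃ b, b = e i * b₀ * e c := ⟨_, rfl⟩
    have hfa : f a = E c i := by simp [ha, hfe, ha₀, hE.mul_eq]
    have hfb : f b = E i c := by simp [hb, hfe, hb₀, hE.mul_eq]
    have hca : e c * a = a := by simp only [ha, ← mul_assoc, hc]
    have hai : a * e i = a := by simp only [ha, mul_assoc, hi]
    have hib : e i * b = b := by simp only [hb, ← mul_assoc, hi]
    have hbc : b * e c = b := by simp only [hb, mul_assoc, hc]
    have hnil : IsNilpotent (a * b - e c) := hf _ (by
      simp [RingHom.mem_ker, hfa, hfb, hfe, hE.mul_eq])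
    obtain ⟨u, hu⟩ := hnil.isUnit_one_add
    have hcu : e c * u = a * b := by
      rw [hu, mul_add, mul_sub, ← mul_assoc, hca, hc, mul_one]
      abel
    have huc : u * e c = a * b := by
      rw [hu, add_mul, sub_mul, mul_assoc, hbc, hc, one_mul]
      abel
    have hvc : (↑u⁻¹ : R) * e c = e c * ↑u⁻¹ := by
      rw [Units.inv_mul_eq_iff_eq_mul, ← mul_assoc, huc, ← hcu, mul_assoc, Units.mul_inv, mul_one]
    have hfu : f u = 1 := by simp [hu, hfa, hfb, hfe, hE.mul_eq]
    have hfv : f (↑u⁻¹ : R) = 1 := by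
      have := congrArg f u.inv_mul
      rwa [map_mul, hfu, mul_one, map_one] at this
    have hab : ↑u⁻¹ * a * b = e c := by
      rw [mul_assoc, ← huc, ← mul_assoc, Units.inv_mul, one_mul]
    have hidem : IsIdempotentElem (e i - b * (↑u⁻¹ * a)) := by
      have h1 : e i * (b * (↑u⁻¹ * a)) = b * (↑u⁻¹ * a) := by rw [← mul_assoc, hib]
      have h2 : b * (↑u⁻¹ * a) * e i = b * (↑u⁻¹ * a) := by rw [mul_assoc, mul_assoc, hai]
      have h3 : b * (↑u⁻¹ * a) * (b * (↑u⁻¹ * a)) = b * (↑u⁻¹ * a) := by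
        rw [mul_assoc, ← mul_assoc _ b, hab, ← mul_assoc b, hbc]
      rw [IsIdempotentElem, sub_mul, mul_sub, mul_sub, hi, h1, h2, h3, sub_self, sub_zero]
    have hzero : e i - b * (↑u⁻¹ * a) = 0 := by
      obtain ⟨N, hN⟩ := hf (e i - b * (↑u⁻¹ * a)) (by
        simp [RingHom.mem_ker, hfa, hfb, hfe, hfv, hE.mul_eq])
      rw [← hidem.pow_succ_eq N, pow_succ, hN, zero_mul]
    exact ⟨↑u⁻¹ * a, b, by rw [map_mul, hfv, one_mul, hfa], hfb, hab, (sub_eq_zero.mp hzero).symm,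
      by rw [mul_assoc, hai], hib, hbc⟩
  choose a b hfa hfb hab hba hai hib hbc using hcorner
  refine ⟨fun i j ↦ b i * a j, ⟨fun i j k l ↦ ?_, ?_⟩, fun i j ↦ ?_⟩
  · split_ifs with h
    · subst h
      rw [mul_assoc, ← mul_assoc (a j), hab, ← mul_assoc, hbc]
    · rw [mul_assoc, ← mul_assoc (a j), ← hai j, ← hib k, mul_assoc (a j), ← mul_assoc (e j),
        he.ortho h]
      simp
  · simp only [hba, he.complete]
  · rw [map_mul, hfa, hfb, hE.mul_eq, if_pos rfl]

/-- An algebra generated as a module by matrix units is a matrix ring over the image of the base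
ring. -/
theorem IsMatrixUnits.nonempty_ringEquiv {ι Z S : Type*} [Fintype ι] [DecidableEq ι] [CommRing Z]
    [Ring S] [Algebra Z S] {f : ι → ι → S} (hf : IsMatrixUnits f) (I : Ideal Z)
    (hI : ∀ z, algebraMap Z S z = 0 ↔ z ∈ I)
    (hspan : ∀ s, s ∈ Submodule.span Z (Set.range fun p : ι × ι ↦ f p.1 p.2)) :
    Nonempty (S ≃+* Matrix ι ι (Z ⧸ I)) := by
  let Φ : Matrix ι ι Z →+* S :=
    { toFun := fun A ↦ ∑ i, ∑ j, A i j • f i j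
      map_one' := by simp [Matrix.one_apply, hf.sum_eq]
      map_zero' := by simp
      map_add' := fun A B ↦ by simp [add_smul, Finset.sum_add_distrib]
      map_mul' := fun A B ↦ by
        have h (i j k : ι) : ∑ l, (A i j * B k l) • (f i j * f k l) =
            if j = k then ∑ l, (A i j * B k l) • f i l else 0 := by
          simp only [hf.mul_eq, smul_ite, smul_zero]
          split_ifs <;> simp
        simp only [Finset.sum_mul_sum, smul_mul_smul_comm, Matrix.mul_apply, Finset.sum_smul, h,
          Finset.sum_ite_eq', Finset.mem_univ, if_true]
        exact Finset.sum_congr rfl fun i _ ↦ Finset.sum_comm }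
  have hΦ (A : Matrix ι ι Z) : Φ A = ∑ i, ∑ j, A i j • f i j := rfl
  have hsurj : Function.Surjective Φ := by
    intro s
    obtain ⟨c, hc⟩ := (Submodule.mem_span_range_iff_exists_fun Z).mp (hspan s)
    exact ⟨Matrix.of fun i j ↦ c (i, j), by simpa [hΦ, Fintype.sum_prod_type] using hc⟩
  have hker (A : Matrix ι ι Z) : Φ A = 0 ↔ ∀ i j, A i j ∈ I := by
    constructor
    · intro h i j
      rw [← hI, Algebra.algebraMap_eq_smul_one, ← hf.sum_eq, Finset.smul_sum]
      refine Finset.sum_eq_zero fun k _ ↦ ?_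
      have : f k i * Φ A * f j k = A i j • f k k := by
        simp [hΦ, Finset.mul_sum, Finset.sum_mul, hf.mul_eq]
      rw [← this, h, mul_zero, zero_mul]
    · intro h
      rw [hΦ]
      refine Finset.sum_eq_zero fun i _ ↦ Finset.sum_eq_zero fun j _ ↦ ?_
      rw [Algebra.smul_def, (hI _).mpr (h i j), zero_mul]
  let Ψ : Matrix ι ι Z →+* Matrix ι ι (Z ⧸ I) := (Ideal.Quotient.mk I).mapMatrix
  have hΨsurj : Function.Surjective Ψ := by
    intro B
    choose A hA using fun i j ↦ Ideal.Quotient.mk_surjective (B i j)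
    exact ⟨Matrix.of A, by ext i j; simp [Ψ, hA]⟩
  have hΨ (A : Matrix ι ι Z) : Ψ A = 0 ↔ ∀ i j, A i j ∈ I := by
    simp [Ψ, ← Matrix.ext_iff, Ideal.Quotient.eq_zero_iff_mem]
  have hcon : RingCon.ker Φ = RingCon.ker Ψ := by
    ext A B
    rw [RingCon.ker_apply, RingCon.ker_apply, ← sub_eq_zero, ← map_sub, hker, ← hΨ, map_sub,
      sub_eq_zero]
  exact ⟨(RingCon.quotientKerEquivOfSurjective Φ hsurj).symm.trans
    ((RingCon.congr (.refl _) hcon).trans (RingCon.quotientKerEquivOfSurjective Ψ hΨsurj))⟩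

theorem exists_fibre_map_of_isPIDegree {k Z T : Type*} [Field k] [IsAlgClosed k] [CommRing Z]
    [IsDomain Z] [Algebra k Z] [Algebra.FiniteType k Z] [Ring T] [Algebra k T] [Algebra Z T]
    [IsScalarTower k Z T] [Module.Finite Z T] [Module.IsTorsionFree Z T] {n : ℕ}
    (hn : IsPIDegree k T n) (M : Ideal Z) (hM : M.IsMaximal)
    (hc : IsCoatom (TwoSidedIdeal.span (algebraMap Z T '' (M : Set Z)))) :
    NeZero n ∧ ∃ ψ : T →ₐ[k] Matrix (Fin n) (Fin n) k, Function.Surjective ψ ∧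
      ∀ t, ψ t = 0 ↔ t ∈ M • (⊤ : Submodule Z T) := by
  obtain ⟨d, hd, ψ, hψ, hker⟩ := exists_fibre_map (k := k) M hM hc
  simp only [mem_twoSidedIdeal_span_algebraMap_image] at hker
  suffices h : n ≤ d by
    obtain rfl := h.antisymm (le_of_isPIDegree hn ψ hψ)
    exact ⟨hd, ψ, hψ, hker⟩
  rcases Nat.eq_zero_or_pos n with rfl | hpos
  · exact Nat.zero_le d
  obtain ⟨V, _, _, _, _, _, hVn⟩ := hn.1
  have := FiniteDimensional.of_finrank_pos (hVn ▸ hpos)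
  obtain ⟨π, hπ⟩ : ∃ π : T →+* Matrix (Fin n) (Fin n) k, Function.Surjective π :=
    hVn ▸ exists_surjective_map_matrix (k := k) (T := T) (V := V)
  choose x hx using fun p : Fin n × Fin n ↦ hπ (Matrix.single p.1 p.2 1)
  choose y hy using fun p : Fin d × Fin d ↦ hψ (Matrix.single p.1 p.2 1)
  obtain ⟨s, hs, hspan⟩ :=
    exists_smul_mem_span_of_map_eq_single M hM.ne_top ψ (fun t ↦ (hker t).mp) y hy
  have h := (linearIndependent_of_map_eq_single π hπ x hx).card_le_of_smul_mem_span y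
    (s := s) (fun h0 ↦ hs (by simp [h0])) hspan
  simpa [Nat.mul_self_le_mul_self_iff] using h

/-- If all fibres of `T` at the maximal ideals over `I` are matrix algebras of the same size, then
`IT` contracts to `I`. -/
theorem algebraMap_mem_smul_top_iff {k Z T ι : Type*} [Field k] [CommRing Z] [IsDomain Z]
    [Algebra k Z] [Ring T] [Algebra k T] [Algebra Z T] [IsScalarTower k Z T] [Module.Finite Z T]
    [Module.IsTorsionFree Z T] [Fintype ι] [DecidableEq ι] [Nonempty ι] (I : Ideal Z)
    (h : ∀ M : Ideal Z, M.IsMaximal → I ≤ M → ∃ ψ : T →ₐ[k] Matrix ι ι k,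
      Function.Surjective ψ ∧ ∀ t, ψ t = 0 ↔ t ∈ M • (⊤ : Submodule Z T)) (z : Z) :
    algebraMap Z T z ∈ I • (⊤ : Submodule Z T) ↔ z ∈ I := by
  refine ⟨fun hz ↦ ?_, fun hz ↦ ?_⟩
  · by_contra hzI
    have hne : I.colon {z} ≠ ⊤ := fun h ↦ hzI (by
      simpa [Submodule.mem_colon_singleton] using (Ideal.eq_top_iff_one _).mp h)
    obtain ⟨M, hM, hle⟩ := Ideal.exists_le_maximal _ hne
    have hIM : I ≤ M := fun a ha ↦ hle (by
      rw [Submodule.mem_colon_singleton]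
      exact I.mul_mem_right z ha)
    obtain ⟨ψ, hψ, hker⟩ := h M hM hIM
    choose x hx using fun p : ι × ι ↦ hψ (Matrix.single p.1 p.2 1)
    have hli := linearIndependent_of_map_eq_single (Z := Z) (ψ : T →+* Matrix ι ι k) hψ x hx
    obtain ⟨s, hs, hspan⟩ :=
      exists_smul_mem_span_of_map_eq_single M hM.ne_top ψ (fun t ↦ (hker t).mp) x hx
    refine hs (hle ?_)
    obtain ⟨c⟩ := ‹Nonempty ι›
    have hmem : (s * z) • x (c, c) ∈ I • Submodule.span Z (Set.range x) := by
      have h1 : z • x (c, c) ∈ I • (⊤ : Submodule Z T) := by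
        rw [← mem_twoSidedIdeal_span_algebraMap_image] at hz ⊢
        rw [Algebra.smul_def]
        exact TwoSidedIdeal.mul_mem_right _ _ _ hz
      rw [mul_smul]
      refine Submodule.smul_induction_on h1 (fun a ha t _ ↦ ?_) fun t u ht hu ↦ ?_
      · rw [smul_comm]
        exact Submodule.smul_mem_smul ha (hspan t)
      · rw [smul_add]
        exact add_mem ht hu
    obtain ⟨a, ha, hsum⟩ := (Submodule.mem_ideal_smul_span_iff_exists_sum I x _).mp hmem
    have heq : a = Finsupp.single (c, c) (s * z) := hli (by
      rw [Finsupp.linearCombination_single, ← hsum, Finsupp.linearCombination_apply])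
    rw [Submodule.mem_colon_singleton, smul_eq_mul]
    simpa [heq] using ha (c, c)
  · rw [Algebra.algebraMap_eq_smul_one]
    exact Submodule.smul_mem_smul hz trivial

theorem mul_mem_mul_smul_top {Z T : Type*} [CommRing Z] [Ring T] [Algebra Z T] {A B : Ideal Z}
    {x y : T} (hx : x ∈ A • (⊤ : Submodule Z T)) (hy : y ∈ B • (⊤ : Submodule Z T)) :
    x * y ∈ (A * B) • (⊤ : Submodule Z T) := by
  refine Submodule.smul_induction_on hx (fun a ha t _ ↦ ?_) fun x₁ x₂ h₁ h₂ ↦ ?_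
  · refine Submodule.smul_induction_on hy (fun b hb u _ ↦ ?_) fun y₁ y₂ h₁ h₂ ↦ ?_
    · rw [smul_mul_smul_comm]
      exact Submodule.smul_mem_smul (Ideal.mul_mem_mul ha hb) trivial
    · rw [mul_add]
      exact add_mem h₁ h₂
  · rw [add_mul]
    exact add_mem h₁ h₂

theorem pow_mem_pow_smul_top {Z T : Type*} [CommRing Z] [Ring T] [Algebra Z T] {A : Ideal Z}
    {x : T} (hx : x ∈ A • (⊤ : Submodule Z T)) (N : ℕ) :
    x ^ N ∈ (A ^ N) • (⊤ : Submodule Z T) := by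
  induction N with
  | zero => simp
  | succ N ih =>
    rw [pow_succ, pow_succ]
    exact mul_mem_mul_smul_top ih hx

/-- For a finite family of pairwise coprime ideals, an element of all the `M i • ⊤` lies in
`(⨅ i, M i) • ⊤`. -/
theorem mem_iInf_smul_top {Z T ι : Type*} [CommRing Z] [AddCommGroup T] [Module Z T] [Finite ι]
    {M : ι → Ideal Z} (hM : Pairwise fun i j ↦ IsCoprime (M i) (M j)) {t : T}
    (ht : ∀ i, t ∈ M i • (⊤ : Submodule Z T)) : t ∈ (⨅ i, M i) • (⊤ : Submodule Z T) := by
  classical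
  cases nonempty_fintype ι
  choose p hp using fun i ↦ Ideal.exists_forall_sub_mem_ideal hM (Pi.single i 1)
  have hsum : 1 - ∑ i, p i ∈ ⨅ i, M i := by
    rw [Ideal.mem_iInf]
    intro j
    have : 1 - ∑ i, p i = -∑ i, (p i - Pi.single (M := fun _ ↦ Z) i 1 j) := by
      simp [Pi.single_apply]
    rw [this]
    exact neg_mem (sum_mem fun i _ ↦ hp i j)
  have hdecomp : t = (1 - ∑ i, p i) • t + ∑ i, p i • t := by
    rw [← Finset.sum_smul, ← add_smul, sub_add_cancel, one_smul]
  rw [hdecomp]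
  refine add_mem (Submodule.smul_mem_smul hsum trivial) (sum_mem fun i _ ↦ ?_)
  refine Submodule.smul_induction_on (ht i) (fun a ha u _ ↦ ?_) fun u v hu hv ↦ ?_
  · rw [← mul_smul]
    refine Submodule.smul_mem_smul ?_ trivial
    rw [Ideal.mem_iInf]
    intro j
    by_cases hij : j = i
    · rw [hij]
      exact (M i).mul_mem_left _ ha
    · exact (M j).mul_mem_right _ (by simpa [hij] using hp i j)
  · rw [smul_add]
    exact add_mem hu hv

/-- If the finitely many fibres of `T` at the maximal ideals over `I` are matrix algebras over `k`
of the same size and `IT` contracts to `I`, then `T/IT` is a matrix algebra over `Z/I`. -/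
theorem nonempty_ringEquiv_matrix_of_fibres {k Z T ι : Type*} [Field k] [CommRing Z]
    [IsNoetherianRing Z] [IsJacobsonRing Z] [Algebra k Z] [Ring T] [Algebra k T] [Algebra Z T]
    [IsScalarTower k Z T] [Module.Finite Z T] [Fintype ι] [DecidableEq ι] (I : Ideal Z)
    (hI : ∀ z, algebraMap Z T z ∈ I • (⊤ : Submodule Z T) ↔ z ∈ I)
    [Finite {M : Ideal Z // M.IsMaximal ∧ I ≤ M}]
    (hfibre : ∀ M : Ideal Z, M.IsMaximal → I ≤ M → ∃ ψ : T →ₐ[k] Matrix ι ι k,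
      Function.Surjective ψ ∧ ∀ t, ψ t = 0 ↔ t ∈ M • (⊤ : Submodule Z T)) :
    Nonempty ((TwoSidedIdeal.span (algebraMap Z T '' (I : Set Z))).ringCon.Quotient ≃+*
      Matrix ι ι (Z ⧸ I)) := by
  classical
  set P := TwoSidedIdeal.span (algebraMap Z T '' (I : Set Z)) with hP
  have hmk : Function.Surjective P.ringCon.mk' := P.ringCon.mk'_surjective
  have hmk0 (t : T) : P.ringCon.mk' t = 0 ↔ t ∈ I • (⊤ : Submodule Z T) := by
    rw [← TwoSidedIdeal.mem_ker, TwoSidedIdeal.ker_ringCon_mk', hP,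
      mem_twoSidedIdeal_span_algebraMap_image]
  have hmksmul (z : Z) (t : T) : P.ringCon.mk' (z • t) = z • P.ringCon.mk' t := rfl
  let X := {M : Ideal Z // M.IsMaximal ∧ I ≤ M}
  cases nonempty_fintype X
  let J : Ideal Z := ⨅ M : X, M.1
  have hcop : Pairwise fun M N : X ↦ IsCoprime M.1 N.1 := fun M N hMN ↦
    have := M.2.1
    have := N.2.1
    Ideal.isCoprime_of_isMaximal (Subtype.coe_injective.ne hMN)
  obtain ⟨N, hN⟩ : ∃ N, J ^ N ≤ I := by
    obtain ⟨N, hN⟩ := I.exists_radical_pow_le_of_fg I.radical.fg_of_isNoetherianRing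
    refine ⟨N, (Ideal.pow_right_mono ?_ N).trans hN⟩
    rw [I.radical_eq_jacobson]
    exact le_sInf fun M hM ↦ iInf_le (fun M : X ↦ M.1) ⟨M, hM.2, hM.1⟩
  choose ψ hψ hker using fun M : X ↦ hfibre M.1 M.2.1 M.2.2
  have hψJ {t : T} (ht : ∀ M, ψ M t = 0) : t ∈ J • (⊤ : Submodule Z T) :=
    mem_iInf_smul_top hcop fun M ↦ (hker M t).mp (ht M)
  have hψsmul {M : X} {z : Z} {a : k} (hz : z - algebraMap k Z a ∈ M.1) (t : T) :
      ψ M (z • t) = a • ψ M t := by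
    rw [← map_smul, ← sub_eq_zero, ← map_sub, hker, ← algebraMap_smul Z a t, ← sub_smul]
    exact Submodule.smul_mem_smul hz trivial
  let Ψ : T →+* (X → Matrix ι ι k) := RingHom.pi fun M ↦ (ψ M : T →+* Matrix ι ι k)
  have hΨ (t : T) (M : X) : Ψ t M = ψ M t := rfl
  have hle : P.ringCon ≤ RingCon.ker Ψ := by
    intro x y hxy
    rw [TwoSidedIdeal.rel_iff, hP, mem_twoSidedIdeal_span_algebraMap_image] at hxy
    rw [RingCon.ker_apply, ← sub_eq_zero, ← map_sub]
    funext M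
    exact (hker M _).mpr (Submodule.smul_mono_left M.2.2 hxy)
  let f := P.ringCon.lift Ψ hle
  have hf (t : T) : f (P.ringCon.mk' t) = Ψ t := rfl
  have hnil : ∀ x ∈ RingHom.ker f, IsNilpotent x := by
    intro x hx
    obtain ⟨t, rfl⟩ := hmk x
    refine ⟨N, ?_⟩
    rw [← map_pow, hmk0]
    exact Submodule.smul_mono_left hN (pow_mem_pow_smul_top (hψJ (congrFun hx)) N)
  let E : ι → ι → X → Matrix ι ι k := fun i j _ ↦ Matrix.single i j 1
  have hE : IsMatrixUnits E := by
    refine ⟨fun i j k l ↦ funext fun M ↦ ?_, funext fun M ↦ ?_⟩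
    · by_cases h : j = k
      · subst h
        simp [E]
      · simp [E, h]
    · simpa [E, Matrix.one_apply, apply_ite (Matrix.single _ _)] using
        (Matrix.matrix_eq_sum_single (1 : Matrix ι ι k)).symm
  have hrange (i j : ι) : E i j ∈ f.range := by
    choose t ht using fun M : X ↦ hψ M (Matrix.single i j 1)
    choose p hp using fun M : X ↦ Ideal.exists_forall_sub_mem_ideal hcop (Pi.single M 1)
    refine ⟨P.ringCon.mk' (∑ M, p M • t M), funext fun M ↦ ?_⟩
    rw [hf, hΨ, map_sum, Finset.sum_eq_single M]
    · rw [hψsmul (a := 1) (by simpa using hp M M), one_smul, ht]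
    · intro M' _ hM'
      rw [hψsmul (a := 0) (by simpa [hM'.symm] using hp M' M), zero_smul]
    · simp
  obtain ⟨F, hF, hfF⟩ := IsMatrixUnits.exists_lift f hnil hE hrange
  refine hF.nonempty_ringEquiv I (fun z ↦ ?_) fun s ↦ ?_
  · rw [← hI, ← hmk0]
    rfl
  choose u hu using fun i j ↦ hmk (F i j)
  have hψu (M : X) (i j : ι) : ψ M (u i j) = Matrix.single i j 1 := by
    rw [← hΨ, ← hf, hu, hfF]
  have htop : (⊤ : Submodule Z T) ≤
      Submodule.span Z (Set.range fun p : ι × ι ↦ u p.1 p.2) ⊔ J • ⊤ := by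
    intro t _
    choose z hz using fun i j ↦
      Ideal.exists_forall_sub_mem_ideal hcop fun M ↦ algebraMap k Z (ψ M t i j)
    rw [← add_sub_cancel (∑ i, ∑ j, z i j • u i j) t]
    refine add_mem (Submodule.mem_sup_left (sum_mem fun i _ ↦ sum_mem fun j _ ↦
      Submodule.smul_mem _ _ (Submodule.subset_span ⟨(i, j), rfl⟩)))
      (Submodule.mem_sup_right (hψJ fun M ↦ ?_))
    rw [map_sub, sub_eq_zero]
    simp only [map_sum, hψsmul (hz _ _ M), hψu, Matrix.smul_single, smul_eq_mul, mul_one]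
    exact Matrix.matrix_eq_sum_single _
  obtain ⟨r, hr, hr'⟩ :=
    Submodule.exists_sub_one_mem_and_smul_le_of_fg_of_le_sup Module.Finite.fg_top le_rfl htop
  obtain ⟨t, rfl⟩ := hmk s
  obtain ⟨a, b, hab⟩ : IsCoprime r ((r - 1) ^ N) := IsCoprime.pow_right ⟨1, -1, by ring⟩
  have hcomb : P.ringCon.mk' t = a • P.ringCon.mk' (r • t) := by
    rw [← hmksmul, ← sub_eq_zero, ← map_sub, hmk0, ← mul_smul]
    nth_rewrite 1 [← one_smul Z t]
    rw [← sub_smul, ← hab, add_sub_cancel_left]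
    exact Submodule.smul_mem_smul (I.mul_mem_left _ (hN (Ideal.pow_mem_pow hr N))) trivial
  rw [hcomb]
  refine Submodule.smul_mem _ _ ?_
  have := Submodule.mem_map_of_mem (f := (P.ringCon.mkₐ Z).toLinearMap)
    (hr' (Submodule.smul_mem_pointwise_smul t r ⊤ trivial))
  rw [Submodule.map_span, ← Set.range_comp] at this
  have hrw : (fun p : ι × ι ↦ F p.1 p.2) =
      (P.ringCon.mkₐ Z).toLinearMap ∘ fun p ↦ u p.1 p.2 := funext fun p ↦ (hu p.1 p.2).symm
  rw [hrw]
  exact this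

/-- Let `R ⊆ Z ⊆ T` with `T` a prime affine `k`-algebra finite over its center `Z` (an affine
domain) and `Z` finite over the affine subalgebra `R`.  If `m` is a maximal ideal of `R` such
that every maximal ideal of `Z` lying over `m` is in the Azumaya locus of `T` (a fully Azumaya
point), then `T/mT ≅ Mat_n(Z/mZ)` where `n` is the PI degree of `T`. -/
theorem stmt9 {k R Z T : Type*} [Field k] [IsAlgClosed k]
    [CommRing R] [Algebra k R] [Algebra.FiniteType k R]
    [CommRing Z] [IsDomain Z] [Algebra k Z] [Algebra.FiniteType k Z]
    [Ring T] [Algebra k T] [Algebra.FiniteType k T]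
    [Algebra Z T] [IsScalarTower k Z T]
    [Algebra R Z] [IsScalarTower k R Z]
    (hprime : ∀ a b : T, (∀ x : T, a * x * b = 0) → a = 0 ∨ b = 0)
    (hinjZT : Function.Injective (algebraMap Z T))
    (hcenter : ∀ t : T, t ∈ Set.center T ↔ ∃ z : Z, algebraMap Z T z = t)
    [Module.Finite Z T]
    (hinjRZ : Function.Injective (algebraMap R Z))
    [Module.Finite R Z]
    (m : Ideal R) (hm : m.IsMaximal)
    (hfullyAz : ∀ M : Ideal Z, M.IsMaximal → M.comap (algebraMap R Z) = m →
      IsCoatom (TwoSidedIdeal.span (algebraMap Z T '' (M : Set Z))))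
    (n : ℕ) (hn : IsPIDegree k T n) :
    Nonempty ((TwoSidedIdeal.span (algebraMap Z T ''
        ((Ideal.map (algebraMap R Z) m) : Set Z))).ringCon.Quotient ≃+*
      Matrix (Fin n) (Fin n) (Z ⧸ Ideal.map (algebraMap R Z) m)) := by
  have htf : Module.IsTorsionFree Z T := by
    refine Module.IsTorsionFree.of_smul_eq_zero fun z t h ↦ ?_
    rw [Algebra.smul_def] at h
    refine (hprime (algebraMap Z T z) t fun x ↦ ?_).imp_left fun hz ↦ hinjZT (by rw [hz, map_zero])
    rw [Algebra.commutes, mul_assoc, h, mul_zero]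
  set I := Ideal.map (algebraMap R Z) m with hI
  have hcomap {M : Ideal Z} (hM : M.IsMaximal) (hIM : I ≤ M) : M.comap (algebraMap R Z) = m :=
    (hm.eq_of_le (Ideal.comap_ne_top _ hM.ne_top) (Ideal.map_le_iff_le_comap.mp hIM)).symm
  have hfibre (M : Ideal Z) (hM : M.IsMaximal) (hIM : I ≤ M) :=
    exists_fibre_map_of_isPIDegree hn M hM (hfullyAz M hM (hcomap hM hIM))
  obtain ⟨M₀, hM₀, hM₀m⟩ := Ideal.exists_ideal_over_maximal_of_isIntegral (S := Z) m (by
    rw [(RingHom.injective_iff_ker_eq_bot _).mp hinjRZ]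
    exact bot_le)
  have hIM₀ : I ≤ M₀ := Ideal.map_le_iff_le_comap.mpr hM₀m.ge
  have := (hfibre M₀ hM₀ hIM₀).1
  have : IsNoetherianRing Z := Algebra.FiniteType.isNoetherianRing k Z
  have : IsJacobsonRing Z := isJacobsonRing_of_finiteType (A := k)
  have : Finite {M : Ideal Z // M.IsMaximal ∧ I ≤ M} :=
    ((Algebra.QuasiFinite.finite_primesOver m).subset fun M hM ↦
      ⟨hM.1.isPrime, ⟨(hcomap hM.1 hM.2).symm⟩⟩).to_subtype
  exact nonempty_ringEquiv_matrix_of_fibres (k := k) I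
    (algebraMap_mem_smul_top_iff (k := k) I fun M hM hIM ↦ (hfibre M hM hIM).2)
    fun M hM hIM ↦ (hfibre M hM hIM).2
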